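/- arXiv:1810.04628 — 2 statements merged into one kernel-verified Lean document; each statement's English description precedes it below -/
import Mathlib

section
/- Let a ∈ ℤ and ν ∈ ℝ with 1 < ν < 2. Then the three functions x_1(t) := 1, x_2(t) := t, and x_3(t) := H_ν(t,a), viewed as functions on ℕ_a, each satisfy ∇[t ↦ (∇_{a*}^ν x)(t)](t) = 0 for all t ∈ ℕ_{a+3}, and they are linearly independent in the ℝ-vector space of functions ℕ_a → ℝ. -/
/-- Nabla (backward) difference: `∇f(t) = f(t) - f(t-1)`. -/
noncomputable def nabla (f : ℤ → ℝ) : ℤ → ℝ := fun t => f t - f (t - 1)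

/-- Nabla fractional Taylor monomial `H_ν(t,a)`, with convention `H_ν(a,a) = 0`. -/
noncomputable def Hmon (ν : ℝ) (t a : ℤ) : ℝ :=
  if t = a then 0
  else Real.Gamma ((t : ℝ) - (a : ℝ) + ν) / (Real.Gamma ((t : ℝ) - (a : ℝ)) * Real.Gamma (ν + 1))

/-- Nabla fractional integral of order `ν` based at `a`:
`(∇_a^{-ν} f)(t) = ∑_{s=a+1}^t H_{ν-1}(t, s-1) f(s)`. -/
noncomputable def fracSum (ν : ℝ) (a : ℤ) (f : ℤ → ℝ) (t : ℤ) : ℝ :=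
  ∑ s ∈ Finset.Icc (a + 1) t, Hmon (ν - 1) t (s - 1) * f s

/-- Nabla Caputo fractional difference of order `ν > 0` based at `a`, with `N = ⌈ν⌉`. -/
noncomputable def caputo (ν : ℝ) (a : ℤ) (f : ℤ → ℝ) (t : ℤ) : ℝ :=
  fracSum ((⌈ν⌉₊ : ℝ) - ν) a (nabla^[⌈ν⌉₊] f) t

/-- The operator `(L_a^ν x)(t) = ∇[p·(∇_{a*}^ν x)](t) + q(t)·x(t-1)`. -/
noncomputable def Lop (ν : ℝ) (a : ℤ) (p q x : ℤ → ℝ) (t : ℤ) : ℝ :=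
  nabla (fun τ => p τ * caputo ν a x τ) t + q t * x (t - 1)

theorem Real.Gamma_add_natCast {x : ℝ} (hx : 0 < x) (n : ℕ) :
    Real.Gamma (x + n) = n.factorial * Ring.multichoose x n * Real.Gamma x := by
  rw [← nsmul_eq_mul, Ring.factorial_nsmul_multichoose_eq_ascPochhammer,
    Polynomial.ascPochhammer_smeval_eq_eval]
  induction n with
  | zero => simp
  | succ n ih =>
    rw [Nat.cast_succ, ← add_assoc, Real.Gamma_add_one (by positivity), ih,
      ascPochhammer_succ_eval]
    ring

/-- **Chu–Vandermonde identity** for multichoose coefficients. -/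
theorem Ring.add_multichoose_eq {R : Type*} [CommRing R] [BinomialRing R] (r s : R) (n : ℕ) :
    Ring.multichoose (r + s) n =
      ∑ ij ∈ Finset.HasAntidiagonal.antidiagonal n,
        Ring.multichoose r ij.1 * Ring.multichoose s ij.2 := by
  have key (x : R) (k : ℕ) : Ring.multichoose x k = (-1) ^ k * Ring.choose (-x) k := by
    rw [Ring.choose_neg', Units.smul_def, zsmul_eq_mul, Int.coe_negOnePow_natCast]
    push_cast
    rw [← mul_assoc, ← mul_pow]
    simp
  rw [key, neg_add, Ring.add_choose_eq n (Commute.all _ _), Finset.mul_sum]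
  refine Finset.sum_congr rfl fun ij hij => ?_
  rw [key r, key s, ← Finset.HasAntidiagonal.mem_antidiagonal.mp hij, pow_add]
  ring

@[simp]
theorem Hmon_self (ν : ℝ) (a : ℤ) : Hmon ν a a = 0 := if_pos rfl

theorem Hmon_add_one_add_natCast {ν : ℝ} (hν : -1 < ν) (a : ℤ) (n : ℕ) :
    Hmon ν (a + 1 + n) a = Ring.multichoose (ν + 1) n := by
  have hG : Real.Gamma (ν + 1) ≠ 0 := (Real.Gamma_pos_of_pos (by linarith)).ne'
  have hn : (n.factorial : ℝ) ≠ 0 := by positivity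
  rw [Hmon, if_neg (by lia)]
  push_cast
  rw [show (a : ℝ) + 1 + n - a + ν = ν + 1 + n by ring,
    show (a : ℝ) + 1 + n - a = n + 1 by ring, Real.Gamma_nat_eq_factorial,
    Real.Gamma_add_natCast (by linarith)]
  field_simp

theorem nabla_Hmon {ν : ℝ} (hν : 0 < ν) {a t : ℤ} (ht : a + 1 ≤ t) :
    nabla (fun r => Hmon ν r a) t = Hmon (ν - 1) t a := by
  obtain ⟨n, rfl⟩ := Int.le.dest ht
  rw [nabla, Hmon_add_one_add_natCast (by linarith), Hmon_add_one_add_natCast (by linarith),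
    sub_add_cancel]
  cases n with
  | zero => simp
  | succ n =>
    rw [show a + 1 + ((n + 1 : ℕ) : ℤ) - 1 = a + 1 + n by push_cast; ring,
      Hmon_add_one_add_natCast (by linarith), Ring.multichoose_succ_succ, add_sub_cancel_right]

theorem nabla_nabla_Hmon {ν : ℝ} (hν : 1 < ν) {a t : ℤ} (ht : a + 1 ≤ t) :
    nabla (nabla fun r => Hmon ν r a) t = Hmon (ν - 2) t a := by
  have h0 : nabla (fun r => Hmon ν r a) a = Hmon (ν - 1) a a := by
    have : Real.Gamma (-1) = 0 := by simpa using Real.Gamma_neg_nat_eq_zero 1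
    simp [nabla, Hmon, this]
  have h (r : ℤ) (hr : a ≤ r) : nabla (fun r => Hmon ν r a) r = Hmon (ν - 1) r a := by
    rcases hr.eq_or_lt with rfl | hr
    · exact h0
    · exact nabla_Hmon (by linarith) hr
  rw [nabla, h t (by lia), h (t - 1) (by lia), show ν - 2 = ν - 1 - 1 by ring,
    ← nabla_Hmon (ν := ν - 1) (by linarith) ht, nabla]

theorem fracSum_Hmon {μ ν : ℝ} (hμ : 0 < μ) (hν : -1 < ν) {a t : ℤ} (ht : a + 1 ≤ t) :
    fracSum μ a (fun s => Hmon ν s a) t = Hmon (ν + μ) t a := by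
  obtain ⟨n, rfl⟩ := Int.le.dest ht
  rw [Hmon_add_one_add_natCast (by linarith), show ν + μ + 1 = μ + (ν + 1) by ring,
    Ring.add_multichoose_eq, fracSum]
  symm
  refine Finset.sum_bij' (fun ij _ => a + 1 + (ij.2 : ℤ))
    (fun s _ => ((a + 1 + n - s).toNat, (s - (a + 1)).toNat)) ?_ ?_ ?_ ?_ ?_
  · intro ij hij
    rw [Finset.HasAntidiagonal.mem_antidiagonal] at hij
    rw [Finset.mem_Icc]
    lia
  · intro s hs
    rw [Finset.mem_Icc] at hs
    rw [Finset.HasAntidiagonal.mem_antidiagonal]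
    lia
  · intro ij hij
    rw [Finset.HasAntidiagonal.mem_antidiagonal] at hij
    ext <;> dsimp only <;> lia
  · intro s hs
    rw [Finset.mem_Icc] at hs
    dsimp only
    lia
  · intro ij hij
    rw [Finset.HasAntidiagonal.mem_antidiagonal] at hij
    rw [Hmon_add_one_add_natCast hν, ← hij,
      show a + 1 + ((ij.1 + ij.2 : ℕ) : ℤ) = (a + 1 + ij.2 - 1) + 1 + ij.1 by push_cast; ring,
      Hmon_add_one_add_natCast (by linarith), sub_add_cancel]

theorem caputo_of_one_lt_of_lt_two {ν : ℝ} (hν1 : 1 < ν) (hν2 : ν < 2) (a : ℤ) (f : ℤ → ℝ) :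
    caputo ν a f = fracSum (2 - ν) a (nabla (nabla f)) := by
  have h : ⌈ν⌉₊ = 2 := by
    rw [Nat.ceil_eq_iff two_ne_zero]
    norm_num
    exact ⟨hν1, hν2.le⟩
  ext t
  rw [caputo, h]
  rfl

theorem caputo_Hmon {ν : ℝ} (hν1 : 1 < ν) (hν2 : ν < 2) {a t : ℤ} (ht : a + 1 ≤ t) :
    caputo ν a (fun r => Hmon ν r a) t = 1 := by
  obtain ⟨n, hn⟩ := Int.le.dest ht
  have h : fracSum (2 - ν) a (nabla (nabla fun r => Hmon ν r a)) t =
      fracSum (2 - ν) a (fun r => Hmon (ν - 2) r a) t :=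
    Finset.sum_congr rfl fun s hs => by rw [nabla_nabla_Hmon hν1 (Finset.mem_Icc.mp hs).1]
  rw [caputo_of_one_lt_of_lt_two hν1 hν2, h, fracSum_Hmon (by linarith) (by linarith) ht, ← hn,
    Hmon_add_one_add_natCast (by linarith), show ν - 2 + (2 - ν) + 1 = 1 by ring,
    Ring.multichoose_one]

/-- `1`, `t`, and `H_ν(t,a)` are three linearly independent solutions of
`∇ ∇_{a*}^ν x = 0` on `ℕ_a`, for `1 < ν < 2`. -/
theorem stmt9 (a : ℤ) (ν : ℝ) (hν1 : 1 < ν) (hν2 : ν < 2) :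
    (∀ t : ℤ, a + 3 ≤ t → nabla (fun τ => caputo ν a (fun _ => (1 : ℝ)) τ) t = 0) ∧
    (∀ t : ℤ, a + 3 ≤ t → nabla (fun τ => caputo ν a (fun r => (r : ℝ)) τ) t = 0) ∧
    (∀ t : ℤ, a + 3 ≤ t → nabla (fun τ => caputo ν a (fun r => Hmon ν r a) τ) t = 0) ∧
    LinearIndependent ℝ
      ![(Set.Ici a).restrict (fun _ : ℤ => (1 : ℝ)),
        (Set.Ici a).restrict (fun r : ℤ => (r : ℝ)),
        (Set.Ici a).restrict (fun r : ℤ => Hmon ν r a)] := by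
  refine ⟨fun t _ => ?_, fun t _ => ?_, fun t ht => ?_, ?_⟩
  · simp [caputo_of_one_lt_of_lt_two hν1 hν2, fracSum, nabla]
  · simp [caputo_of_one_lt_of_lt_two hν1 hν2, fracSum, nabla]
  · rw [nabla, caputo_Hmon hν1 hν2 (by lia), caputo_Hmon hν1 hν2 (by lia), sub_self]
  · have h1 : Hmon ν (a + 1) a = 1 := by
      simpa using Hmon_add_one_add_natCast (ν := ν) (by linarith) a 0
    have h2 : Hmon ν (a + 2) a = ν + 1 := by
      simpa [add_assoc] using Hmon_add_one_add_natCast (ν := ν) (by linarith) a 1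
    rw [Fintype.linearIndependent_iff]
    intro c hc
    have key (r : ℤ) (hr : a ≤ r) : c 0 + c 1 * r + c 2 * Hmon ν r a = 0 := by
      simpa [Fin.sum_univ_three, Set.restrict] using congrFun hc ⟨r, hr⟩
    have e0 := key a le_rfl
    have e1 := key (a + 1) (by lia)
    have e2 := key (a + 2) (by lia)
    rw [Hmon_self] at e0
    rw [h1] at e1
    rw [h2] at e2
    push_cast at e1 e2
    have hc2 : c 2 = 0 := by
      have : c 2 * (ν - 1) = 0 := by linear_combination e0 - 2 * e1 + e2
      exact (mul_eq_zero.mp this).resolve_right (by linarith)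
    have hc1 : c 1 = 0 := by linear_combination e1 - e0 - hc2
    have hc0 : c 0 = 0 := by linear_combination e0 - a * hc1
    intro i
    fin_cases i <;> assumption
end

section
/- Let a ∈ ℤ, f : ℤ → ℝ, μ ∈ ℝ with μ > 0 and μ ∉ ℤ. Then for all t ∈ ℤ with t ≥ a + 1, (∇_a^{−μ}(∇_a^{μ} f))(t) = f(t), where ∇_a^{μ} is the Riemann–Liouville fractional difference of order μ. -/
/-- Riemann–Liouville nabla fractional difference of order `μ > 0` based at `a`,
with `M = ⌈μ⌉`. -/
noncomputable def rlDiff (μ : ℝ) (a : ℤ) (f : ℤ → ℝ) : ℤ → ℝ :=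
  nabla^[⌈μ⌉₊] (fracSum ((⌈μ⌉₊ : ℝ) - μ) a f)

open PowerSeries in
/-- The power series `(1 - X)^(-ν)`. -/
noncomputable def negBinomialSeries (ν : ℝ) : PowerSeries ℝ :=
  rescale (-1) (binomialSeries ℝ (-ν))

/-- The generating series of `f` based at `a`, with coefficients `f (a + 1 + n)`. -/
noncomputable def generatingSeries (a : ℤ) (f : ℤ → ℝ) : PowerSeries ℝ :=
  PowerSeries.mk fun n => f (a + 1 + n)

theorem negBinomialSeries_add (μ ν : ℝ) :
    negBinomialSeries (μ + ν) = negBinomialSeries μ * negBinomialSeries ν := by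
  simp only [negBinomialSeries, neg_add, PowerSeries.binomialSeries_add, map_mul]

theorem negBinomialSeries_natCast_mul_pow (M : ℕ) :
    negBinomialSeries M * (1 - PowerSeries.X) ^ M = 1 := by
  have h : (1 - PowerSeries.X : PowerSeries ℝ) ^ M = negBinomialSeries (-M) := by
    simp [negBinomialSeries, sub_eq_add_neg]
  rw [h, ← negBinomialSeries_add]
  simp [negBinomialSeries]

theorem coeff_negBinomialSeries (ν : ℝ) (n : ℕ) :
    PowerSeries.coeff n (negBinomialSeries ν) = Ring.multichoose ν n := by
  simp only [negBinomialSeries, PowerSeries.coeff_rescale, PowerSeries.binomialSeries_coeff,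
    Ring.choose_neg', Units.smul_def, smul_eq_mul, mul_one, zsmul_eq_mul]
  rw [Int.cast_negOnePow_natCast, ← mul_assoc, ← mul_pow]
  simp

theorem Gamma_add_natCast_eq_multichoose {ν : ℝ} (hν : 0 < ν) (n : ℕ) :
    Real.Gamma (n + ν) = Real.Gamma ν * (n.factorial * Ring.multichoose ν n) := by
  rw [← nsmul_eq_mul, Ring.factorial_nsmul_multichoose_eq_ascPochhammer,
    Polynomial.ascPochhammer_smeval_eq_eval]
  induction n with
  | zero => simp
  | succ n ih =>
    rw [ascPochhammer_succ_eval, ← mul_assoc, ← ih, Nat.cast_succ, add_right_comm,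
      Real.Gamma_add_one (by positivity)]
    ring

theorem Hmon_eq_multichoose {ν : ℝ} (hν : 0 < ν) {t s : ℤ} {n : ℕ} (h : t = s + n) :
    Hmon (ν - 1) t (s - 1) = Ring.multichoose ν n := by
  subst h
  have hG := (Real.Gamma_pos_of_pos hν).ne'
  have hn : (n.factorial : ℝ) ≠ 0 := by positivity
  rw [Hmon, if_neg (by lia)]
  push_cast
  rw [show (s + n - (s - 1) + (ν - 1) : ℝ) = n + ν by ring,
    show (s + n - (s - 1) : ℝ) = n + 1 by ring, sub_add_cancel, Real.Gamma_nat_eq_factorial,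
    Gamma_add_natCast_eq_multichoose hν]
  field_simp

theorem generatingSeries_fracSum {ν : ℝ} (hν : 0 < ν) (a : ℤ) (f : ℤ → ℝ) :
    generatingSeries a (fracSum ν a f) = negBinomialSeries ν * generatingSeries a f := by
  ext n
  simp only [generatingSeries, PowerSeries.coeff_mk, fracSum, PowerSeries.coeff_mul,
    coeff_negBinomialSeries]
  refine Finset.sum_nbij' (fun s => ((a + 1 + n - s).toNat, (s - a - 1).toNat))
    (fun p => a + 1 + p.2) ?_ ?_ ?_ ?_ ?_
  · intro s hs
    simp only [Finset.mem_Icc, Finset.HasAntidiagonal.mem_antidiagonal] at hs ⊢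
    lia
  · intro p hp
    simp only [Finset.mem_Icc, Finset.HasAntidiagonal.mem_antidiagonal] at hp ⊢
    lia
  · intro s hs
    simp only [Finset.mem_Icc] at hs ⊢
    lia
  · intro p hp
    simp only [Finset.HasAntidiagonal.mem_antidiagonal] at hp
    ext <;> simp only <;> lia
  · intro s hs
    simp only [Finset.mem_Icc] at hs
    rw [Hmon_eq_multichoose hν (n := (a + 1 + n - s).toNat) (by lia)]
    congr 2
    lia

theorem fracSum_eq_zero (ν : ℝ) (f : ℤ → ℝ) {a t : ℤ} (h : t ≤ a) : fracSum ν a f t = 0 := by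
  rw [fracSum, Finset.Icc_eq_empty (by lia), Finset.sum_empty]

theorem generatingSeries_nabla {a : ℤ} {g : ℤ → ℝ} (hg : g a = 0) :
    generatingSeries a (nabla g) = (1 - PowerSeries.X) * generatingSeries a g := by
  ext n
  rw [sub_mul, one_mul, map_sub]
  cases n with
  | zero => simp [generatingSeries, nabla, hg]
  | succ n =>
    rw [PowerSeries.coeff_succ_X_mul]
    simp only [generatingSeries, nabla, PowerSeries.coeff_mk]
    congr 2
    push_cast
    ring

theorem generatingSeries_nabla_iterate {a : ℤ} {g : ℤ → ℝ} (hg : ∀ t ≤ a, g t = 0) (M : ℕ) :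
    generatingSeries a (nabla^[M] g) = (1 - PowerSeries.X) ^ M * generatingSeries a g := by
  induction M generalizing g with
  | zero => simp
  | succ M ih =>
    rw [Function.iterate_succ_apply, ih, generatingSeries_nabla (hg a le_rfl), pow_succ, mul_assoc]
    intro t ht
    simp [nabla, hg t ht, hg (t - 1) (by lia)]

/-- Composition rule: `∇_a^{-μ} ∇_a^{μ} f = f`. -/
theorem stmt13 (a : ℤ) (f : ℤ → ℝ) (μ : ℝ) (hμ : 0 < μ) (hint : ∀ n : ℤ, μ ≠ n) :
    ∀ t : ℤ, a + 1 ≤ t → fracSum μ a (rlDiff μ a f) t = f t := by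
  intro t ht
  have hM : 0 < (⌈μ⌉₊ : ℝ) - μ :=
    sub_pos.2 ((Nat.le_ceil μ).lt_of_ne (by exact_mod_cast hint ⌈μ⌉₊))
  have h : generatingSeries a (fracSum μ a (rlDiff μ a f)) = generatingSeries a f := by
    rw [generatingSeries_fracSum hμ, rlDiff,
      generatingSeries_nabla_iterate fun _ => fracSum_eq_zero _ _, generatingSeries_fracSum hM,
      mul_left_comm, ← mul_assoc (negBinomialSeries μ), ← negBinomialSeries_add,
      add_sub_cancel, ← mul_assoc, mul_comm (_ ^ _), negBinomialSeries_natCast_mul_pow, one_mul]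
  obtain ⟨n, rfl⟩ := Int.le.dest ht
  simpa [generatingSeries] using congrArg (PowerSeries.coeff n) h
end
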